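/- Let D, Ξ ∈ ℂ^{N×UN} be written in N×N blocks, let c ∈ ℂ^N, let Σ ∈ ℂ^{U×U} be Hermitian, let M ≥ 1, and let μ_0, …, μ_{M−1} ∈ ℂ^U and y_0, …, y_{M−1} ∈ ℂ^N. For ν ∈ ℝ^U define Ψ(ν) = D + Ξ(diag(ν) ⊗ I_N), T(ν) = Ψ(ν)(I_U ⊗ c), and the real-valued function L(ν) = −M Re Tr{T(ν)ᴴ T(ν) Σ} − Σ_{m=0}^{M−1} ‖y_m − Ψ(ν)(μ_m ⊗ c)‖². Define G ∈ ℝ^{U×U} and z ∈ ℝ^U by G_{u,l} = M Re{ cᴴ Ξ_uᴴ Ξ_l c · Σ_{l,u} } + Σ_{m=0}^{M−1} Re{ μ_{m,u} conj(μ_{m,l}) (Ξ_l c)ᴴ (Ξ_u c) } and z_u = Σ_{m=0}^{M−1} Re{ [y_m − D(μ_m ⊗ c)]ᴴ Ξ_u (μ_{m,u} c) } − M Re{ cᴴ Ξ_uᴴ D (I_U ⊗ c) Σ_{:,u} }. Then for every critical point ν̂ of L (i.e. every ν̂ ∈ ℝ^U with all partial derivatives of L vanishing at ν̂), one has G ν̂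 = z. -/

import Mathlib

open Matrix Finset

/-- Partial derivatives of a real quadratic function with symmetric quadratic part. -/
theorem fderiv_quadratic_single {ι : Type*} [Fintype ι] [DecidableEq ι]
    (G : Matrix ι ι ℝ) (hG : G.IsSymm) (z : ι → ℝ) (k : ℝ) (x : ι → ℝ) (u : ι) :
    fderiv ℝ (fun ν : ι → ℝ => k + 2 * (z ⬝ᵥ ν) - ν ⬝ᵥ G *ᵥ ν) x (Pi.single u 1)
      = 2 * (z u - (G *ᵥ x) u) := by
  have hd : DifferentiableAt ℝ (fun ν : ι → ℝ => k + 2 * (z ⬝ᵥ ν) - ν ⬝ᵥ G *ᵥ ν) x := by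
    simp only [dotProduct, mulVec]
    fun_prop
  rw [← hd.lineDeriv_eq_fderiv]
  have hline : (fun t : ℝ => k + 2 * (z ⬝ᵥ (x + t • Pi.single u 1))
        - (x + t • Pi.single u 1) ⬝ᵥ G *ᵥ (x + t • Pi.single u 1))
      = fun t : ℝ => (k + 2 * (z ⬝ᵥ x) - x ⬝ᵥ G *ᵥ x)
        + t * (2 * (z u - (G *ᵥ x) u)) - t ^ 2 * G u u := by
    funext t
    have hs : x ⬝ᵥ G *ᵥ Pi.single u 1 = (G *ᵥ x) u := by
      rw [dotProduct_mulVec, ← mulVec_transpose, hG.eq, dotProduct_single_one]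
    simp only [mulVec_add, mulVec_smul, dotProduct_add, add_dotProduct, dotProduct_smul,
      smul_dotProduct, hs, single_one_dotProduct, dotProduct_single_one, smul_eq_mul]
    simp
    ring
  have hder : HasDerivAt (fun t : ℝ => (k + 2 * (z ⬝ᵥ x) - x ⬝ᵥ G *ᵥ x)
        + t * (2 * (z u - (G *ᵥ x) u)) - t ^ 2 * G u u) (2 * (z u - (G *ᵥ x) u)) 0 := by
    have h := (((hasDerivAt_id (0 : ℝ)).mul_const (2 * (z u - (G *ᵥ x) u))).const_add
      (k + 2 * (z ⬝ᵥ x) - x ⬝ᵥ G *ᵥ x)).sub (((hasDerivAt_id (0 : ℝ)).pow 2).mul_const (G u u))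
    refine (h.congr_deriv (by simp)).congr_of_eventuallyEq (.of_forall fun t => ?_)
    simp
  rw [lineDeriv, hline]
  exact hder.deriv

/-- The real part of the Hermitian form weighted by `S` is symmetric. -/
theorem re_star_dotProduct_mul_comm {κ ι : Type*} [Fintype κ] {S : Matrix ι ι ℂ}
    (hS : S.IsHermitian) (a b : κ → ℂ) (u l : ι) :
    ((star a ⬝ᵥ b) * S l u).re = ((star b ⬝ᵥ a) * S u l).re := by
  rw [← Complex.conj_re, map_mul, starRingEnd_apply, starRingEnd_apply, hS.apply,
    ← star_dotProduct_star, star_star]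

/-- Expansion of `Re Tr (Tᴴ T S)` for a matrix `T` with columns `d u + ν u • w u`. -/
theorem re_trace_conjTranspose_mul_mul {κ ι : Type*} [Fintype κ] [Fintype ι]
    {S : Matrix ι ι ℂ} (hS : S.IsHermitian) (d w : ι → κ → ℂ) (ν : ι → ℝ)
    (T : Matrix κ ι ℂ) (hT : ∀ i u, T i u = d u i + (ν u : ℂ) * w u i) :
    ((Tᴴ * T * S).trace).re
      = (∑ u, ∑ l, ((star (d u) ⬝ᵥ d l) * S l u).re)
        + 2 * ∑ u, ν u * ∑ l, ((star (w u) ⬝ᵥ d l) * S l u).re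
        + ∑ u, ν u * ∑ l, ((star (w u) ⬝ᵥ w l) * S l u).re * ν l := by
  have h : ((Tᴴ * T * S).trace).re = ∑ u, ∑ l, (((star (d u) ⬝ᵥ d l) * S l u).re
      + ν u * ((star (w u) ⬝ᵥ d l) * S l u).re + ν l * ((star (w l) ⬝ᵥ d u) * S u l).re
      + ν u * (((star (w u) ⬝ᵥ w l) * S l u).re * ν l)) := by
    simp only [trace, diag_apply, Matrix.mul_apply (M := Tᴴ * T), Complex.re_sum]
    refine sum_congr rfl fun u _ => sum_congr rfl fun l _ => ?_
    have e : (Tᴴ * T) u l = star (d u + (ν u : ℂ) • w u) ⬝ᵥ (d l + (ν l : ℂ) • w l) := by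
      simp [Matrix.mul_apply, dotProduct, hT]
    rw [e, re_star_dotProduct_mul_comm hS (w l) (d u)]
    simp only [star_add, star_smul, dotProduct_add, add_dotProduct, dotProduct_smul,
      smul_dotProduct, smul_eq_mul, add_mul, Complex.add_re, mul_assoc, Complex.star_def,
      Complex.conj_ofReal, Complex.re_ofReal_mul]
    ring
  rw [h]
  simp only [sum_add_distrib]
  rw [sum_comm (f := fun u l => ν l * ((star (w l) ⬝ᵥ d u) * S u l).re)]
  simp only [mul_sum]
  simp only [two_mul, sum_add_distrib]
  ring

/-- Expansion of the squared norm of the residual `r - ∑ u, ν u • a u`. -/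
theorem re_star_sub_dotProduct_sub {κ ι : Type*} [Fintype κ] [Fintype ι]
    (r : κ → ℂ) (a : ι → κ → ℂ) (ν : ι → ℝ) :
    (star (r - ∑ u, (ν u : ℂ) • a u) ⬝ᵥ (r - ∑ u, (ν u : ℂ) • a u)).re
      = (star r ⬝ᵥ r).re - 2 * ∑ u, ν u * (star r ⬝ᵥ a u).re
        + ∑ u, ν u * ∑ l, (star (a l) ⬝ᵥ a u).re * ν l := by
  have hc : ∀ u, (star (a u) ⬝ᵥ r).re = (star r ⬝ᵥ a u).re := fun u => by
    rw [← Complex.conj_re, starRingEnd_apply, ← star_dotProduct_star, star_star]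
  simp only [star_sub, star_sum, star_smul, sub_dotProduct, dotProduct_sub, sum_dotProduct,
    dotProduct_sum, dotProduct_smul, smul_dotProduct, smul_eq_mul, Complex.star_def,
    Complex.conj_ofReal, Complex.sub_re, Complex.re_sum, Complex.re_ofReal_mul, hc, mul_sum]
  have e : ∀ i x, ν i * (ν x * (star (a x) ⬝ᵥ a i).re)
      = ν i * ((star (a x) ⬝ᵥ a i).re * ν x) := fun i x => by ring
  simp only [mul_sub, mul_sum, sum_sub_distrib, e, two_mul, sum_add_distrib]
  ring

/-- **The stationarity system `G ν̂ = z` of the off-grid update** (equation (nu) of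
the paper).  With `Ψ(ν) = D + Ξ(diag(ν) ⊗ I_N)`, `T(ν) = Ψ(ν)(I_U ⊗ c)`, `Σ`
Hermitian, and `L(ν) = −M Re Tr{T(ν)ᴴT(ν)Σ} − ∑_m ‖y_m − Ψ(ν)(μ_m ⊗ c)‖²`,
every critical point `ν̂` of `L` satisfies `G ν̂ = z`, where
`G_{u,l} = M Re{cᴴ Ξ_uᴴ Ξ_l c Σ_{l,u}} + ∑_m Re{μ_{m,u} conj(μ_{m,l}) (Ξ_l c)ᴴ(Ξ_u c)}`
and `z_u = ∑_m Re{[y_m − D(μ_m ⊗ c)]ᴴ Ξ_u (μ_{m,u} c)} − M Re{cᴴ Ξ_uᴴ D (I_U ⊗ c) Σ_{:,u}}`. -/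
theorem offgrid_critical_point_linear_system {N U M : ℕ} (hM : 1 ≤ M)
    (D Ξ : Matrix (Fin N) (Fin U × Fin N) ℂ)
    (Ξb : Fin U → Matrix (Fin N) (Fin N) ℂ)
    (hΞb : ∀ u, Ξb u = Matrix.of fun i j => Ξ i (u, j))
    (c : Fin N → ℂ) (S : Matrix (Fin U) (Fin U) ℂ) (hS : S.IsHermitian)
    (μ : Fin M → Fin U → ℂ) (y : Fin M → Fin N → ℂ)
    (Ψf : (Fin U → ℝ) → Matrix (Fin N) (Fin U × Fin N) ℂ)
    (hΨf : ∀ ν, Ψf ν = D + Ξ * Matrix.of fun q r =>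
        (if q.1 = r.1 then ((ν q.1 : ℝ) : ℂ) else 0) * (if q.2 = r.2 then 1 else 0))
    (T : (Fin U → ℝ) → Matrix (Fin N) (Fin U) ℂ)
    (hT : ∀ ν, T ν = Ψf ν * Matrix.of fun q p => if q.1 = p then c q.2 else 0)
    (L : (Fin U → ℝ) → ℝ)
    (hL : ∀ ν, L ν = -(M : ℝ) * (((T ν)ᴴ * T ν * S).trace).re
        - ∑ m, (star (y m - (Ψf ν).mulVec fun q => μ m q.1 * c q.2)
            ⬝ᵥ (y m - (Ψf ν).mulVec fun q => μ m q.1 * c q.2)).re)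
    (G : Matrix (Fin U) (Fin U) ℝ)
    (hG : ∀ u l, G u l
        = (M : ℝ) * ((star c ⬝ᵥ ((Ξb u)ᴴ * Ξb l).mulVec c) * S l u).re
          + ∑ m, (μ m u * (starRingEnd ℂ) (μ m l)
              * (star ((Ξb l).mulVec c) ⬝ᵥ (Ξb u).mulVec c)).re)
    (z : Fin U → ℝ)
    (hz : ∀ u, z u
        = (∑ m, ((star (y m - D.mulVec fun q : Fin U × Fin N => μ m q.1 * c q.2))
            ⬝ᵥ (Ξb u).mulVec (μ m u • c)).re)
          - (M : ℝ) * (star c ⬝ᵥ (Ξb u)ᴴ.mulVec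
              ((D * Matrix.of fun (q : Fin U × Fin N) (p : Fin U) => if q.1 = p then c q.2 else 0).mulVec
                fun l => S l u)).re) :
    ∀ νhat : Fin U → ℝ,
      (∀ u, fderiv ℝ L νhat (Pi.single u 1) = 0) → G.mulVec νhat = z := by

  intro νhat hcrit
  set w : Fin U → Fin N → ℂ := fun u => Ξb u *ᵥ c with hw
  set d : Fin U → Fin N → ℂ := fun u i => (D * Matrix.of fun (q : Fin U × Fin N) (p : Fin U) =>
    if q.1 = p then c q.2 else 0) i u with hd
  set r : Fin M → Fin N → ℂ := fun m => y m - D *ᵥ fun q => μ m q.1 * c q.2 with hr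
  have hΨ : ∀ ν i q, Ψf ν i q = D i q + Ξ i q * (ν q.1 : ℂ) := by
    intro ν i q
    have h : Ψf ν i q = D i q + ∑ p, Ξ i p *
        ((if p.1 = q.1 then (ν p.1 : ℂ) else 0) * (if p.2 = q.2 then 1 else 0)) := by
      rw [hΨf]
      rfl
    rw [h, Fintype.sum_prod_type]
    simp
  have hw' : ∀ u i, w u i = ∑ j, Ξ i (u, j) * c j := by
    intro u i
    simp [hw, hΞb, mulVec, dotProduct]
  have hTcol : ∀ ν i u, T ν i u = d u i + (ν u : ℂ) * w u i := by
    intro ν i u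
    have h : T ν i u = ∑ q, Ψf ν i q * (if q.1 = u then c q.2 else 0) := by
      rw [hT]
      rfl
    rw [h, hw', hd]
    simp only [Matrix.mul_apply, Fintype.sum_prod_type, hΨ, of_apply, mul_ite, mul_zero, add_mul,
      sum_ite_irrel, sum_const_zero, sum_ite_eq', mem_univ, if_true, sum_add_distrib, mul_sum]
    congr 1
    exact sum_congr rfl fun j _ => by ring
  have hres : ∀ ν m, (y m - Ψf ν *ᵥ fun q => μ m q.1 * c q.2)
      = r m - ∑ u, (ν u : ℂ) • (μ m u • w u) := by
    intro ν m
    ext i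
    simp only [hr, Pi.sub_apply, mulVec, dotProduct, hΨ, add_mul, sum_add_distrib,
      Finset.sum_apply, Pi.smul_apply, smul_eq_mul, hw', mul_sum, Fintype.sum_prod_type]
    rw [sub_sub]
    congr 2
    exact sum_congr rfl fun u _ => sum_congr rfl fun j _ => by ring
  have hG' : ∀ u l, G u l = (M : ℝ) * ((star (w u) ⬝ᵥ w l) * S l u).re
      + ∑ m, (star (μ m l • w l) ⬝ᵥ (μ m u • w u)).re := by
    intro u l
    rw [hG, ← mulVec_mulVec, dotProduct_mulVec, ← star_mulVec]
    congr 1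
    refine sum_congr rfl fun m _ => ?_
    simp only [star_smul, dotProduct_smul, smul_dotProduct, smul_eq_mul, Complex.star_def, hw,
      mul_assoc]
  have hz' : ∀ u, z u = (∑ m, (star (r m) ⬝ᵥ (μ m u • w u)).re)
      - (M : ℝ) * ∑ l, ((star (w u) ⬝ᵥ d l) * S l u).re := by
    intro u
    rw [hz, dotProduct_mulVec, ← star_mulVec]
    congr 2
    · exact funext fun m => by rw [mulVec_smul]
    · rw [← Complex.re_sum, dotProduct_mulVec]
      rfl
  have hsymm : G.IsSymm := by
    ext u l
    rw [transpose_apply, hG', hG', re_star_dotProduct_mul_comm hS]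
    congr 1
    refine sum_congr rfl fun m _ => ?_
    simpa using re_star_dotProduct_mul_comm (S := (1 : Matrix Unit Unit ℂ))
      isHermitian_one (μ m u • w u) (μ m l • w l) () ()
  have hquad : L = fun ν => (-(M : ℝ) * (∑ u, ∑ l, ((star (d u) ⬝ᵥ d l) * S l u).re)
      - ∑ m, (star (r m) ⬝ᵥ r m).re) + 2 * (z ⬝ᵥ ν) - ν ⬝ᵥ G *ᵥ ν := by
    funext ν
    have hzν : z ⬝ᵥ ν = (∑ m, ∑ u, ν u * (star (r m) ⬝ᵥ (μ m u • w u)).re)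
        - (M : ℝ) * ∑ u, ν u * ∑ l, ((star (w u) ⬝ᵥ d l) * S l u).re := by
      rw [sum_comm, mul_sum, ← sum_sub_distrib]
      refine sum_congr rfl fun u _ => ?_
      rw [hz', ← mul_sum]
      ring
    have hGν : ν ⬝ᵥ G *ᵥ ν
        = (M : ℝ) * (∑ u, ν u * ∑ l, ((star (w u) ⬝ᵥ w l) * S l u).re * ν l)
          + ∑ m, ∑ u, ν u * ∑ l, (star (μ m l • w l) ⬝ᵥ (μ m u • w u)).re * ν l := by
      rw [sum_comm, mul_sum, ← sum_add_distrib]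
      refine sum_congr rfl fun u _ => ?_
      rw [← mul_sum, sum_comm, mul_left_comm, ← mul_add, mul_sum, ← sum_add_distrib]
      congr 1
      rw [mulVec, dotProduct]
      refine sum_congr rfl fun l _ => ?_
      rw [hG', ← sum_mul]
      ring
    rw [hL, re_trace_conjTranspose_mul_mul hS d w ν (T ν) (hTcol ν), hzν, hGν]
    simp only [hres, re_star_sub_dotProduct_sub, sum_add_distrib, sum_sub_distrib, ← mul_sum]
    ring
  funext u
  have h := hcrit u
  rw [hquad, fderiv_quadratic_single G hsymm] at h
  linarith
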